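/- Let N and T be quantum channels and suppose T is an additive extension of N, i.e., there exists a quantum channel R with N = R∘T and Q(T) = Q^(1)(T). Then the quantum capacity of N satisfies Q(N) ≤ Q^(1)(T). -/

import Mathlib

open scoped Matrix Kronecker ComplexOrder

/-- A finite family of Kraus operators from input space `A` to output space `B`. -/
structure KrausFamily (A B : Type) [Fintype A] [DecidableEq A] [Fintype B] [DecidableEq B] :
    Type 1 where
  ι : Type
  [fι : Fintype ι]
  [dι : DecidableEq ι]
  K : ι → Matrix B A ℂ

attribute [instance] KrausFamily.fι KrausFamily.dι

variable {A B : Type} [Fintype A] [DecidableEq A] [Fintype B] [DecidableEq B]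

/-- The trace-preservation condition `Σ Kᵢ† Kᵢ = 1` making a Kraus family a quantum channel. -/
def KrausFamily.IsChannel (N : KrausFamily A B) : Prop :=
  ∑ i, (N.K i)ᴴ * N.K i = 1

/-- The action of a channel: `N(ρ) = Σ Kᵢ ρ Kᵢ†`. -/
noncomputable def KrausFamily.apply (N : KrausFamily A B) (ρ : Matrix A A ℂ) : Matrix B B ℂ :=
  ∑ i, N.K i * ρ * (N.K i)ᴴ

/-- The complementary channel: `N̂(ρ)ᵢⱼ = Tr (Kᵢ ρ Kⱼ†)`. -/
noncomputable def KrausFamily.compl (N : KrausFamily A B) (ρ : Matrix A A ℂ) :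
    Matrix N.ι N.ι ℂ :=
  Matrix.of fun i j => (N.K i * ρ * (N.K j)ᴴ).trace

/-- Von Neumann entropy, base 2: `S(ρ) = −Σ λⱼ log₂ λⱼ` over the eigenvalues of `ρ`
(junk value `0` for non-Hermitian matrices). -/
noncomputable def vnEntropy {n : Type} [Fintype n] [DecidableEq n] (ρ : Matrix n n ℂ) : ℝ :=
  if h : ρ.IsHermitian then -∑ j, h.eigenvalues j * Real.logb 2 (h.eigenvalues j) else 0

/-- A density matrix: positive semidefinite with unit trace. -/
def IsDensity {n : Type} [Fintype n] (ρ : Matrix n n ℂ) : Prop :=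
  ρ.PosSemidef ∧ ρ.trace = 1

/-- Coherent information of `N` at input `φ`: `I^c(N,φ) = S(N(φ)) − S(N̂(φ))`. -/
noncomputable def cohInfo (N : KrausFamily A B) (φ : Matrix A A ℂ) : ℝ :=
  vnEntropy (N.apply φ) - vnEntropy (N.compl φ)

/-- One-shot quantum capacity: `Q^{(1)}(N) = sup_φ I^c(N,φ)` over density matrices `φ`. -/
noncomputable def Q1 (N : KrausFamily A B) : ℝ :=
  sSup {x | ∃ φ : Matrix A A ℂ, IsDensity φ ∧ x = cohInfo N φ}

/-- The `n`-th tensor power of a Kraus family, whose Kraus operators are all `n`-fold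
Kronecker products of Kraus operators of `N`. -/
noncomputable def KrausFamily.pow (N : KrausFamily A B) (n : ℕ) :
    KrausFamily (Fin n → A) (Fin n → B) where
  ι := Fin n → N.ι
  K f := Matrix.of fun b a => ∏ i, N.K (f i) (b i) (a i)

/-- Quantum capacity: `Q(N) = sup_{n ≥ 1} (1/n) Q^{(1)}(N^{⊗n})`. -/
noncomputable def Qcap (N : KrausFamily A B) : ℝ :=
  sSup {x | ∃ n : ℕ, 0 < n ∧ x = (1 / (n : ℝ)) * Q1 (N.pow n)}

/-- `N` is degradable if some channel `D` maps its output to its complementary output. -/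
def KrausFamily.IsDegradable (N : KrausFamily A B) : Prop :=
  ∃ D : KrausFamily B N.ι, D.IsChannel ∧ ∀ ρ : Matrix A A ℂ, D.apply (N.apply ρ) = N.compl ρ

/-- `N` is antidegradable if some channel `D` maps its complementary output to its output. -/
def KrausFamily.IsAntidegradable (N : KrausFamily A B) : Prop :=
  ∃ D : KrausFamily N.ι B, D.IsChannel ∧ ∀ ρ : Matrix A A ℂ, D.apply (N.compl ρ) = N.apply ρ

section EntropyViaCharpoly

/-- The von Neumann entropy is a sum over the roots of the characteristic polynomial. -/
theorem vnEntropy_eq_sum_roots {n : Type} [Fintype n] [DecidableEq n] {ρ : Matrix n n ℂ}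
    (h : ρ.IsHermitian) :
    vnEntropy ρ = -(ρ.charpoly.roots.map fun z : ℂ => z.re * Real.logb 2 z.re).sum := by
  rw [vnEntropy, dif_pos h, h.roots_charpoly_eq_eigenvalues, Multiset.map_map]
  simp

theorem Multiset.sum_map_roots_X_pow_mul (f : ℂ → ℝ) (hf : f 0 = 0) (k : ℕ)
    {P : Polynomial ℂ} (hP : P ≠ 0) :
    ((Polynomial.X ^ k * P).roots.map f).sum = (P.roots.map f).sum := by
  rw [Polynomial.roots_mul (mul_ne_zero (pow_ne_zero _ Polynomial.X_ne_zero) hP)]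
  simp [Multiset.map_nsmul, Multiset.sum_nsmul, hf]

/-- `M Mᴴ` and `Mᴴ M` have the same entropy, having the same nonzero spectrum. -/
theorem vnEntropy_mul_conjTranspose_self {m n : Type} [Fintype m] [DecidableEq m]
    [Fintype n] [DecidableEq n] (M : Matrix m n ℂ) :
    vnEntropy (M * Mᴴ) = vnEntropy (Mᴴ * M) := by
  rw [vnEntropy_eq_sum_roots (Matrix.isHermitian_mul_conjTranspose_self M),
    vnEntropy_eq_sum_roots (Matrix.isHermitian_conjTranspose_mul_self M),
    ← Multiset.sum_map_roots_X_pow_mul _ (by simp) (Fintype.card n)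
      (Matrix.charpoly_monic (M * Mᴴ)).ne_zero,
    Matrix.charpoly_mul_comm',
    Multiset.sum_map_roots_X_pow_mul _ (by simp) _ (Matrix.charpoly_monic (Mᴴ * M)).ne_zero]

theorem vnEntropy_transpose {n : Type} [Fintype n] [DecidableEq n] {ρ : Matrix n n ℂ}
    (h : ρ.IsHermitian) : vnEntropy ρᵀ = vnEntropy ρ := by
  rw [vnEntropy_eq_sum_roots h, vnEntropy_eq_sum_roots h.transpose, Matrix.charpoly_transpose]

end EntropyViaCharpoly

section EntropyBounds

theorem IsDensity.sum_eigenvalues {n : Type} [Fintype n] [DecidableEq n] {ρ : Matrix n n ℂ}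
    (h : IsDensity ρ) : ∑ i, h.1.isHermitian.eigenvalues i = 1 := by
  have := h.1.isHermitian.trace_eq_sum_eigenvalues
  have h1 := h.2.symm.trans this
  rw [← Complex.ofReal_inj, Complex.ofReal_sum, Complex.ofReal_one]
  exact h1.symm

theorem vnEntropy_nonneg {n : Type} [Fintype n] [DecidableEq n] {ρ : Matrix n n ℂ}
    (h : IsDensity ρ) : 0 ≤ vnEntropy ρ := by
  rw [vnEntropy, dif_pos h.1.isHermitian, neg_nonneg]
  refine Finset.sum_nonpos fun i _ => ?_
  have h0 := h.1.eigenvalues_nonneg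
  refine mul_nonpos_of_nonneg_of_nonpos (h0 i)
    (Real.logb_nonpos one_lt_two (h0 i) ?_)
  rw [← h.sum_eigenvalues]
  exact Finset.single_le_sum (fun j _ => h0 j) (Finset.mem_univ i)

theorem vnEntropy_le_logb_card {n : Type} [Fintype n] [DecidableEq n] {ρ : Matrix n n ℂ}
    (h : IsDensity ρ) : vnEntropy ρ ≤ Real.logb 2 (Fintype.card n) := by
  have h0 := h.1.eigenvalues_nonneg
  have hs := h.sum_eigenvalues
  rw [vnEntropy, dif_pos h.1.isHermitian]
  set p := h.1.isHermitian.eigenvalues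
  have hn : Nonempty n := by
    by_contra hn
    rw [not_nonempty_iff] at hn
    simp at hs
  have hd : (0 : ℝ) < Fintype.card n := by exact_mod_cast Fintype.card_pos
  have key : ∀ i, -(p i * Real.log (p i)) ≤
      p i * Real.log (Fintype.card n) + (1 / Fintype.card n - p i) := by
    intro i
    rcases (h0 i).eq_or_lt with hp | hp
    · have hp' : p i = 0 := hp.symm
      simp [hp']
    · have hp' : 0 < p i := hp
      have h1 := Real.log_le_sub_one_of_pos (x := 1 / (p i * Fintype.card n)) (by positivity)
      rw [one_div, Real.log_inv, Real.log_mul hp'.ne' hd.ne'] at h1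
      have h2 := mul_le_mul_of_nonneg_left h1 hp'.le
      have h3 : p i * ((p i * (Fintype.card n : ℝ))⁻¹ - 1) = 1 / Fintype.card n - p i := by
        field_simp
      rw [h3] at h2
      linarith
  have hsum := Finset.sum_le_sum fun i (_ : i ∈ Finset.univ) => key i
  rw [Finset.sum_add_distrib, Finset.sum_sub_distrib, ← Finset.sum_mul, hs,
    Finset.sum_neg_distrib] at hsum
  have hone : ∑ _i : n, (1 / (Fintype.card n : ℝ)) = 1 := by simp
  rw [hone] at hsum
  simp only [Real.logb, mul_div_assoc', ← Finset.sum_div, ← neg_div]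
  gcongr
  linarith

end EntropyBounds

section LogIntegral

open Filter Topology

theorem hasDerivAt_mul_log_add_mul {w p q t : ℝ} (hp : 0 ≤ p) (hq : 0 ≤ q) (ht : 0 < t) :
    HasDerivAt (fun s => w * p * Real.log (q + s * p)) (w * (p ^ 2 / (q + t * p))) t := by
  rcases hp.eq_or_lt with rfl | hp
  · simpa using hasDerivAt_const t (0 : ℝ)
  · have h1 : HasDerivAt (fun s => q + s * p) p t := by
      simpa using ((hasDerivAt_id t).mul_const p).const_add q
    have h2 := (h1.log (by positivity)).const_mul (w * p)
    refine h2.congr_deriv ?_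
    ring

theorem tendsto_mul_log_add_mul_zero {w p q : ℝ} (hs : q = 0 → w * p = 0) :
    Tendsto (fun s => w * p * Real.log (q + s * p)) (𝓝[>] 0) (𝓝 (w * p * Real.log q)) := by
  by_cases hq : q = 0
  · simp [hs hq]
  · have h1 : ContinuousAt (fun s : ℝ => w * p * Real.log (q + s * p)) 0 := by
      refine ContinuousAt.mul continuousAt_const (ContinuousAt.log (by fun_prop) (by simpa))
    have h2 := h1.tendsto
    simp only [zero_mul, add_zero] at h2
    exact h2.mono_left nhdsWithin_le_nhds

theorem tendsto_mul_log_add_mul_atTop {w p q : ℝ} (hp : 0 ≤ p) (hq : 0 ≤ q) :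
    Tendsto (fun s => w * p * Real.log (q + s * p) - w * p * Real.log s) atTop
      (𝓝 (w * p * Real.log p)) := by
  rcases hp.eq_or_lt with rfl | hp
  · simp
  · have h1 : Tendsto (fun s : ℝ => q * s⁻¹ + p) atTop (𝓝 (q * 0 + p)) :=
      (tendsto_inv_atTop_zero.const_mul q).add_const p
    rw [mul_zero, zero_add] at h1
    have h2 := (h1.log hp.ne').const_mul (w * p)
    refine h2.congr' ?_
    filter_upwards [eventually_gt_atTop 0] with s hs
    have h3 : q * s⁻¹ + p = (q + s * p) / s := by field_simp
    rw [h3, Real.log_div (by positivity) hs.ne']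
    ring

/-- Integrating an inequality between the sums `∑ w p² / (q + t p)` over `t > 0` yields an
inequality between the sums `∑ w p (log p - log q)`. -/
theorem sum_mul_log_le_of_sum_sq_div_le {α β : Type*} [Fintype α] [Fintype β]
    {w p q : α → ℝ} {w' p' q' : β → ℝ}
    (hp : ∀ a, 0 ≤ p a) (hq : ∀ a, 0 ≤ q a) (hs : ∀ a, q a = 0 → w a * p a = 0)
    (hp' : ∀ b, 0 ≤ p' b) (hq' : ∀ b, 0 ≤ q' b) (hs' : ∀ b, q' b = 0 → w' b * p' b = 0)
    (htr : ∑ a, w a * p a = ∑ b, w' b * p' b)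
    (hle : ∀ t : ℝ, 0 < t → ∑ b, w' b * (p' b ^ 2 / (q' b + t * p' b)) ≤
      ∑ a, w a * (p a ^ 2 / (q a + t * p a))) :
    ∑ b, w' b * p' b * Real.log (p' b) - ∑ b, w' b * p' b * Real.log (q' b) ≤
      ∑ a, w a * p a * Real.log (p a) - ∑ a, w a * p a * Real.log (q a) := by
  set F : ℝ → ℝ := fun s => ∑ a, w a * p a * Real.log (q a + s * p a) with hF
  set F' : ℝ → ℝ := fun s => ∑ b, w' b * p' b * Real.log (q' b + s * p' b) with hF'
  have hder : ∀ t : ℝ, 0 < t → HasDerivAt (fun s => F s - F' s)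
      (∑ a, w a * (p a ^ 2 / (q a + t * p a)) - ∑ b, w' b * (p' b ^ 2 / (q' b + t * p' b))) t :=
    fun t ht => (HasDerivAt.fun_sum fun a _ => hasDerivAt_mul_log_add_mul (hp a) (hq a) ht).sub
      (HasDerivAt.fun_sum fun b _ => hasDerivAt_mul_log_add_mul (hp' b) (hq' b) ht)
  have hmono : MonotoneOn (fun s => F s - F' s) (Set.Ioi 0) := by
    refine monotoneOn_of_deriv_nonneg (convex_Ioi 0)
      (fun t ht => (hder t ht).continuousAt.continuousWithinAt)
      (fun t ht => (hder t (interior_subset ht)).differentiableAt.differentiableWithinAt)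
      fun t ht => ?_
    rw [(hder t (interior_subset ht)).deriv, sub_nonneg]
    exact hle t (interior_subset ht)
  have h0 : Tendsto (fun s => F s - F' s) (𝓝[>] 0)
      (𝓝 (∑ a, w a * p a * Real.log (q a) - ∑ b, w' b * p' b * Real.log (q' b))) :=
    (tendsto_finsetSum _ fun a _ => tendsto_mul_log_add_mul_zero (hs a)).sub
      (tendsto_finsetSum _ fun b _ => tendsto_mul_log_add_mul_zero (hs' b))
  have hinf : Tendsto (fun s => F s - F' s) atTop
      (𝓝 (∑ a, w a * p a * Real.log (p a) - ∑ b, w' b * p' b * Real.log (p' b))) := by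
    have h1 := (tendsto_finsetSum Finset.univ fun a _ =>
        tendsto_mul_log_add_mul_atTop (w := w a) (hp a) (hq a)).sub
      (tendsto_finsetSum Finset.univ fun b _ =>
        tendsto_mul_log_add_mul_atTop (w := w' b) (hp' b) (hq' b))
    refine h1.congr fun s => ?_
    simp only [Finset.sum_sub_distrib, ← Finset.sum_mul, htr, hF, hF']
    ring
  have hlim : ∀ᶠ T : ℝ in atTop,
      ∑ a, w a * p a * Real.log (q a) - ∑ b, w' b * p' b * Real.log (q' b) ≤ F T - F' T := by
    filter_upwards [eventually_gt_atTop 0] with T hT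
    refine le_of_tendsto h0 ?_
    filter_upwards [Ioo_mem_nhdsGT hT] with s hs
    exact hmono hs.1 hT hs.2.le
  have := ge_of_tendsto hinf hlim
  linarith

end LogIntegral

section SpectralDecomposition

/-- `ρ = U diag(p) U†` with `U` unitary and `p` nonnegative. -/
structure SpectralDecomp {n : Type} [Fintype n] [DecidableEq n]
    (ρ U : Matrix n n ℂ) (p : n → ℝ) : Prop where
  unitary : Uᴴ * U = 1
  eq : ρ = U * Matrix.diagonal (fun i => (p i : ℂ)) * Uᴴ
  nonneg : ∀ i, 0 ≤ p i

/-- The squared moduli of the overlaps between the columns of `V` and those of `U`. -/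
noncomputable def overlap {n : Type} [Fintype n] (U V : Matrix n n ℂ) (x : n × n) : ℝ :=
  Complex.normSq ((Vᴴ * U) x.1 x.2)

variable {n : Type} [Fintype n] [DecidableEq n] {ρ σ U V : Matrix n n ℂ} {p q : n → ℝ}

theorem Matrix.PosSemidef.spectralDecomp (h : ρ.PosSemidef) :
    SpectralDecomp ρ (h.isHermitian.eigenvectorUnitary : Matrix n n ℂ)
      h.isHermitian.eigenvalues where
  unitary := by
    rw [← Matrix.star_eq_conjTranspose]
    exact Unitary.coe_star_mul_self _
  eq := by
    conv_lhs => rw [h.isHermitian.spectral_theorem, Unitary.conjStarAlgAut_apply]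
    rfl
  nonneg := h.eigenvalues_nonneg

theorem SpectralDecomp.posSemidef (h : SpectralDecomp ρ U p) : ρ.PosSemidef := by
  rw [h.eq]
  refine Matrix.PosSemidef.mul_mul_conjTranspose_same (Matrix.PosSemidef.diagonal fun i => ?_) U
  exact Complex.zero_le_real.mpr (h.nonneg i)

theorem Matrix.PosSemidef.exists_eq_mul_conjTranspose (h : ρ.PosSemidef) :
    ∃ X : Matrix n n ℂ, ρ = X * Xᴴ := by
  obtain ⟨hU, hρ, hp⟩ := h.spectralDecomp
  refine ⟨h.isHermitian.eigenvectorUnitary *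
    Matrix.diagonal fun i => (√(h.isHermitian.eigenvalues i) : ℂ), ?_⟩
  conv_lhs => rw [hρ]
  rw [Matrix.conjTranspose_mul, Matrix.diagonal_conjTranspose, ← Matrix.mul_assoc,
    Matrix.mul_assoc _ (Matrix.diagonal _) (Matrix.diagonal _), Matrix.diagonal_mul_diagonal]
  congr 3
  ext i
  simp only [Pi.star_apply, Complex.star_def, Complex.conj_ofReal, ← Complex.ofReal_mul,
    Real.mul_self_sqrt (hp i)]

theorem SpectralDecomp.trace_eq (h : SpectralDecomp ρ U p) : ρ.trace = ∑ i, (p i : ℂ) := by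
  rw [h.eq, Matrix.trace_mul_comm, ← Matrix.mul_assoc, h.unitary, Matrix.one_mul,
    Matrix.trace_diagonal]

theorem SpectralDecomp.sum_overlap (h : SpectralDecomp ρ U p) (hV : Vᴴ * V = 1) (i : n) :
    ∑ j, overlap U V (j, i) = 1 := by
  have h1 : (Vᴴ * U)ᴴ * (Vᴴ * U) = 1 := by
    rw [Matrix.conjTranspose_mul, Matrix.conjTranspose_conjTranspose, Matrix.mul_assoc,
      ← Matrix.mul_assoc V, mul_eq_one_comm.mp hV, Matrix.one_mul, h.unitary]
  have h2 := congrFun (congrFun h1 i) i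
  rw [Matrix.mul_apply, Matrix.one_apply_eq] at h2
  have h3 : ∑ j, (overlap U V (j, i) : ℂ) = 1 := by
    rw [← h2]
    refine Finset.sum_congr rfl fun j _ => ?_
    rw [overlap, Complex.normSq_eq_conj_mul_self, Matrix.conjTranspose_apply]
    rfl
  exact_mod_cast h3

theorem SpectralDecomp.sum_overlap_mul (h : SpectralDecomp ρ U p) (hV : Vᴴ * V = 1)
    (f : n → ℝ) : ∑ x : n × n, overlap U V x * f x.2 = ∑ i, f i := by
  rw [Fintype.sum_prod_type_right]
  refine Finset.sum_congr rfl fun i _ => ?_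
  change ∑ j, overlap U V (j, i) * f i = f i
  rw [← Finset.sum_mul, h.sum_overlap hV, one_mul]

theorem SpectralDecomp.sum_overlap_mul_eq_diag (h : SpectralDecomp ρ U p)
    (V : Matrix n n ℂ) (j : n) :
    ((∑ i, overlap U V (j, i) * p i : ℝ) : ℂ) = (Vᴴ * ρ * V) j j := by
  have h1 : Vᴴ * ρ * V = (Vᴴ * U) * Matrix.diagonal (fun i => (p i : ℂ)) * (Vᴴ * U)ᴴ := by
    conv_lhs => rw [h.eq]
    simp only [Matrix.conjTranspose_mul, Matrix.conjTranspose_conjTranspose, Matrix.mul_assoc]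
  rw [h1, Matrix.mul_apply]
  push_cast
  refine Finset.sum_congr rfl fun i _ => ?_
  rw [Matrix.mul_diagonal, Matrix.conjTranspose_apply, overlap, Complex.normSq_eq_conj_mul_self,
    starRingEnd_apply]
  ring

end SpectralDecomposition

section VariationalFormula

/-- The concave quadratic form in `X` whose maximum is `∑ w p² / (q + t p)`. -/
noncomputable def quadForm {n : Type} [Fintype n] (ρ σ : Matrix n n ℂ) (t : ℝ)
    (X : Matrix n n ℂ) : ℝ :=
  2 * (Xᴴ * ρ).trace.re - (Xᴴ * σ * X).trace.re - t * (X * ρ * Xᴴ).trace.re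

variable {n : Type} [Fintype n] [DecidableEq n] {ρ σ U V : Matrix n n ℂ} {p q : n → ℝ}

theorem quadForm_eq_sum (hρ : SpectralDecomp ρ U p) (hσ : SpectralDecomp σ V q) (t : ℝ)
    (Z : Matrix n n ℂ) :
    quadForm ρ σ t (V * Z * Uᴴ) = ∑ x : n × n,
      (2 * (star (Z x.1 x.2) * (Vᴴ * U) x.1 x.2).re * p x.2
        - Complex.normSq (Z x.1 x.2) * (q x.1 + t * p x.2)) := by
  have e1 : ((V * Z * Uᴴ)ᴴ * ρ).trace = ∑ x : n × n,
      star (Z x.1 x.2) * (Vᴴ * U) x.1 x.2 * p x.2 := by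
    have : ((V * Z * Uᴴ)ᴴ * ρ).trace
        = (Zᴴ * ((Vᴴ * U) * Matrix.diagonal (fun i => (p i : ℂ)))).trace := by
      rw [hρ.eq]
      simp only [Matrix.conjTranspose_mul, Matrix.conjTranspose_conjTranspose, Matrix.mul_assoc]
      rw [Matrix.trace_mul_comm]
      simp only [Matrix.mul_assoc, hρ.unitary, Matrix.mul_one]
    rw [this, Matrix.trace, Fintype.sum_prod_type_right]
    refine Finset.sum_congr rfl fun i _ => ?_
    rw [Matrix.diag_apply, Matrix.mul_apply]
    refine Finset.sum_congr rfl fun j _ => ?_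
    rw [Matrix.mul_diagonal, Matrix.conjTranspose_apply]
    ring
  have e2 : ((V * Z * Uᴴ)ᴴ * σ * (V * Z * Uᴴ)).trace = ∑ x : n × n,
      ((Complex.normSq (Z x.1 x.2) * q x.1 : ℝ) : ℂ) := by
    have : ((V * Z * Uᴴ)ᴴ * σ * (V * Z * Uᴴ)).trace
        = (Zᴴ * (Matrix.diagonal (fun i => (q i : ℂ)) * Z)).trace := by
      rw [hσ.eq]
      simp only [Matrix.conjTranspose_mul, Matrix.conjTranspose_conjTranspose, Matrix.mul_assoc]
      rw [Matrix.trace_mul_comm]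
      simp only [Matrix.mul_assoc, hρ.unitary, Matrix.mul_one]
      simp only [← Matrix.mul_assoc Vᴴ V, hσ.unitary, Matrix.one_mul]
    rw [this, Matrix.trace, Fintype.sum_prod_type_right]
    refine Finset.sum_congr rfl fun i _ => ?_
    rw [Matrix.diag_apply, Matrix.mul_apply]
    refine Finset.sum_congr rfl fun j _ => ?_
    rw [Matrix.diagonal_mul, Matrix.conjTranspose_apply]
    push_cast
    rw [Complex.normSq_eq_conj_mul_self, starRingEnd_apply]
    ring
  have e3 : ((V * Z * Uᴴ) * ρ * (V * Z * Uᴴ)ᴴ).trace = ∑ x : n × n,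
      ((Complex.normSq (Z x.1 x.2) * p x.2 : ℝ) : ℂ) := by
    have : ((V * Z * Uᴴ) * ρ * (V * Z * Uᴴ)ᴴ).trace
        = (Z * (Matrix.diagonal (fun i => (p i : ℂ)) * Zᴴ)).trace := by
      rw [hρ.eq]
      simp only [Matrix.conjTranspose_mul, Matrix.conjTranspose_conjTranspose, Matrix.mul_assoc]
      rw [Matrix.trace_mul_comm]
      simp only [Matrix.mul_assoc, hσ.unitary, Matrix.mul_one]
      simp only [← Matrix.mul_assoc Uᴴ U, hρ.unitary, Matrix.one_mul]
    rw [this, Matrix.trace, Fintype.sum_prod_type]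
    refine Finset.sum_congr rfl fun j _ => ?_
    rw [Matrix.diag_apply, Matrix.mul_apply]
    refine Finset.sum_congr rfl fun i _ => ?_
    rw [Matrix.diagonal_mul, Matrix.conjTranspose_apply]
    push_cast
    rw [Complex.normSq_eq_conj_mul_self, starRingEnd_apply]
    ring
  rw [quadForm, e1, e2, e3, ← Complex.ofReal_sum, ← Complex.ofReal_sum, Complex.ofReal_re,
    Complex.ofReal_re, Complex.re_sum]
  simp only [Complex.re_mul_ofReal, Finset.mul_sum, ← Finset.sum_sub_distrib]
  exact Finset.sum_congr rfl fun x _ => by ring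

theorem quadForm_le (hρ : SpectralDecomp ρ U p) (hσ : SpectralDecomp σ V q) {t : ℝ}
    (ht : 0 < t) (X : Matrix n n ℂ) :
    quadForm ρ σ t X ≤
      ∑ x : n × n, overlap U V x * (p x.2 ^ 2 / (q x.1 + t * p x.2)) := by
  have hX : X = V * (Vᴴ * X * U) * Uᴴ := by
    simp only [Matrix.mul_assoc, mul_eq_one_comm.mp hρ.unitary, Matrix.mul_one]
    rw [← Matrix.mul_assoc, mul_eq_one_comm.mp hσ.unitary, Matrix.one_mul]
  rw [hX, quadForm_eq_sum hρ hσ]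
  refine Finset.sum_le_sum fun x _ => ?_
  rw [overlap]
  generalize (Vᴴ * X * U) x.1 x.2 = z
  generalize (Vᴴ * U) x.1 x.2 = c
  have hp := hρ.nonneg x.2
  have hq := hσ.nonneg x.1
  rcases hp.eq_or_lt with hp0 | hp0
  · rw [← hp0]
    have := mul_nonneg (Complex.normSq_nonneg z) hq
    simp
    linarith
  · have hd : 0 < q x.1 + t * p x.2 := by positivity
    rw [mul_div_assoc', le_div_iff₀ hd]
    simp only [Complex.normSq_apply, Complex.star_def, Complex.mul_re, Complex.conj_re,
      Complex.conj_im]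
    nlinarith [sq_nonneg (c.re * p x.2 - z.re * (q x.1 + t * p x.2)),
      sq_nonneg (c.im * p x.2 - z.im * (q x.1 + t * p x.2))]

theorem exists_quadForm_eq (hρ : SpectralDecomp ρ U p) (hσ : SpectralDecomp σ V q) {t : ℝ}
    (ht : 0 < t) : ∃ X, quadForm ρ σ t X =
      ∑ x : n × n, overlap U V x * (p x.2 ^ 2 / (q x.1 + t * p x.2)) := by
  refine ⟨V * (Matrix.of fun j i => (Vᴴ * U) j i * ((p i / (q j + t * p i) : ℝ) : ℂ)) * Uᴴ, ?_⟩
  rw [quadForm_eq_sum hρ hσ]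
  refine Finset.sum_congr rfl fun x _ => ?_
  rw [overlap, Matrix.of_apply]
  generalize (Vᴴ * U) x.1 x.2 = c
  have hp := hρ.nonneg x.2
  have hq := hσ.nonneg x.1
  rcases hp.eq_or_lt with hp0 | hp0
  · simp [← hp0]
  · have hd : 0 < q x.1 + t * p x.2 := by positivity
    simp only [Complex.normSq_apply, Complex.star_def, Complex.mul_re, Complex.conj_re,
      Complex.conj_im, Complex.ofReal_re, Complex.ofReal_im, Complex.mul_im]
    field_simp
    ring

end VariationalFormula

section Monotonicity

variable {m n κ : Type} [Fintype m] [Fintype n] [DecidableEq n] [Fintype κ]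

/-- Traced form of the Kadison–Schwarz inequality `Φ*(Y)† Φ*(Y) ≤ Φ*(Y† Y)`. -/
theorem trace_schwarz {K : κ → Matrix m n ℂ} (hK : ∑ k, (K k)ᴴ * K k = 1)
    {ρ : Matrix n n ℂ} (hρ : ρ.PosSemidef) (Y : Matrix m m ℂ) :
    ((∑ k, (K k)ᴴ * Y * K k) * ρ * (∑ k, (K k)ᴴ * Y * K k)ᴴ).trace.re ≤
      (Y * (∑ k, K k * ρ * (K k)ᴴ) * Yᴴ).trace.re := by
  set X := ∑ k, (K k)ᴴ * Y * K k with hX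
  have hXH : Xᴴ = ∑ k, (K k)ᴴ * Yᴴ * K k := by
    simp [hX, Matrix.conjTranspose_sum, Matrix.conjTranspose_mul, Matrix.mul_assoc]
  have hpos : 0 ≤ ∑ k, ((Y * K k - K k * X) * ρ * (Y * K k - K k * X)ᴴ).trace.re :=
    Finset.sum_nonneg fun k _ =>
      (Complex.le_def.mp (hρ.mul_mul_conjTranspose_same (Y * K k - K k * X)).trace_nonneg).1
  have h1 : ∑ k, (Y * K k * ρ * (K k)ᴴ * Yᴴ).trace =
      (Y * (∑ k, K k * ρ * (K k)ᴴ) * Yᴴ).trace := by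
    simp only [Finset.mul_sum, Finset.sum_mul, Matrix.trace_sum, Matrix.mul_assoc]
  have h2 : ∑ k, (Y * K k * ρ * Xᴴ * (K k)ᴴ).trace = (X * ρ * Xᴴ).trace := by
    have : X * ρ * Xᴴ = ∑ k, (K k)ᴴ * Y * K k * (ρ * Xᴴ) := by
      rw [← Finset.sum_mul, ← hX, Matrix.mul_assoc]
    rw [this, Matrix.trace_sum]
    refine Finset.sum_congr rfl fun k _ => ?_
    rw [Matrix.trace_mul_comm]
    simp only [Matrix.mul_assoc]
  have h3 : ∑ k, (K k * X * ρ * (K k)ᴴ * Yᴴ).trace = (X * ρ * Xᴴ).trace := by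
    conv_rhs => rw [hXH]
    simp only [Finset.mul_sum, Matrix.trace_sum]
    refine Finset.sum_congr rfl fun k _ => ?_
    simp only [Matrix.mul_assoc]
    rw [Matrix.trace_mul_comm]
    simp only [Matrix.mul_assoc]
  have h4 : ∑ k, (K k * X * ρ * Xᴴ * (K k)ᴴ).trace = (X * ρ * Xᴴ).trace := by
    have : X * ρ * Xᴴ = (∑ k, (K k)ᴴ * K k) * (X * ρ * Xᴴ) := by rw [hK, Matrix.one_mul]
    conv_rhs => rw [this]
    simp only [Finset.sum_mul, Matrix.trace_sum]
    refine Finset.sum_congr rfl fun k _ => ?_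
    rw [Matrix.trace_mul_comm]
    simp only [Matrix.mul_assoc]
  have hexp : ∑ k, ((Y * K k - K k * X) * ρ * (Y * K k - K k * X)ᴴ).trace =
      (Y * (∑ k, K k * ρ * (K k)ᴴ) * Yᴴ).trace - (X * ρ * Xᴴ).trace := by
    have : ∀ k, ((Y * K k - K k * X) * ρ * (Y * K k - K k * X)ᴴ).trace =
        (Y * K k * ρ * (K k)ᴴ * Yᴴ).trace - (Y * K k * ρ * Xᴴ * (K k)ᴴ).trace -
          (K k * X * ρ * (K k)ᴴ * Yᴴ).trace + (K k * X * ρ * Xᴴ * (K k)ᴴ).trace := by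
      intro k
      simp only [Matrix.conjTranspose_sub, Matrix.conjTranspose_mul, Matrix.sub_mul,
        Matrix.mul_sub, Matrix.trace_sub, Matrix.mul_assoc]
      ring
    simp only [this, Finset.sum_add_distrib, Finset.sum_sub_distrib, h1, h2, h3, h4]
    ring
  rw [← Complex.re_sum, hexp, Complex.sub_re] at hpos
  linarith

theorem quadForm_map_le {K : κ → Matrix m n ℂ} (hK : ∑ k, (K k)ᴴ * K k = 1)
    {ρ σ : Matrix n n ℂ} (hρ : ρ.PosSemidef) (hσ : σ.PosSemidef) {t : ℝ} (ht : 0 ≤ t)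
    (Y : Matrix m m ℂ) :
    quadForm (∑ k, K k * ρ * (K k)ᴴ) (∑ k, K k * σ * (K k)ᴴ) t Y ≤
      quadForm ρ σ t (∑ k, (K k)ᴴ * Y * K k) := by
  have hXH : (∑ k, (K k)ᴴ * Y * K k)ᴴ = ∑ k, (K k)ᴴ * Yᴴ * K k := by
    simp [Matrix.conjTranspose_sum, Matrix.conjTranspose_mul, Matrix.mul_assoc]
  have h1 : (Yᴴ * ∑ k, K k * ρ * (K k)ᴴ).trace = ((∑ k, (K k)ᴴ * Y * K k)ᴴ * ρ).trace := by
    rw [hXH]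
    simp only [Finset.mul_sum, Finset.sum_mul, Matrix.trace_sum]
    refine Finset.sum_congr rfl fun k _ => ?_
    rw [← Matrix.mul_assoc, Matrix.trace_mul_comm]
    simp only [Matrix.mul_assoc]
  have h2 := trace_schwarz hK hσ Yᴴ
  rw [← hXH, Matrix.conjTranspose_conjTranspose, Matrix.conjTranspose_conjTranspose] at h2
  have h3 := mul_le_mul_of_nonneg_left (trace_schwarz hK hρ Y) ht
  rw [quadForm, quadForm, h1]
  linarith

theorem trace_map {K : κ → Matrix m n ℂ} (hK : ∑ k, (K k)ᴴ * K k = 1) (ρ : Matrix n n ℂ) :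
    (∑ k, K k * ρ * (K k)ᴴ).trace = ρ.trace := by
  conv_rhs => rw [← Matrix.one_mul ρ, ← hK]
  simp only [Finset.sum_mul, Matrix.trace_sum]
  refine Finset.sum_congr rfl fun k _ => ?_
  rw [Matrix.trace_mul_comm, Matrix.mul_assoc]

theorem SpectralDecomp.overlap_mul_eq_zero {ρ U V : Matrix n n ℂ} {p : n → ℝ}
    (h : SpectralDecomp ρ U p) {j : n} (hj : ∑ i, overlap U V (j, i) * p i = 0) (i : n) :
    overlap U V (j, i) * p i = 0 :=
  (Finset.sum_eq_zero_iff_of_nonneg fun i _ =>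
    mul_nonneg (Complex.normSq_nonneg _) (h.nonneg i)).mp hj i (Finset.mem_univ i)

/-- Monotonicity of the relative entropy under quantum channels, in terms of spectral data. -/
theorem relEntropy_map_le [DecidableEq m] {K : κ → Matrix m n ℂ} (hK : ∑ k, (K k)ᴴ * K k = 1)
    {ρ σ U V : Matrix n n ℂ} {p q : n → ℝ} {U' V' : Matrix m m ℂ} {p' q' : m → ℝ}
    (hρ : SpectralDecomp ρ U p) (hσ : SpectralDecomp σ V q)
    (hρ' : SpectralDecomp (∑ k, K k * ρ * (K k)ᴴ) U' p')
    (hσ' : SpectralDecomp (∑ k, K k * σ * (K k)ᴴ) V' q')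
    (hs : ∀ j, q j = 0 → ∑ i, overlap U V (j, i) * p i = 0)
    (hs' : ∀ j, q' j = 0 → ∑ i, overlap U' V' (j, i) * p' i = 0) :
    ∑ i, p' i * Real.log (p' i) - ∑ j, (∑ i, overlap U' V' (j, i) * p' i) * Real.log (q' j) ≤
      ∑ i, p i * Real.log (p i) - ∑ j, (∑ i, overlap U V (j, i) * p i) * Real.log (q j) := by
  have htr : ∑ i, p i = ∑ i, p' i := by
    have h := trace_map hK ρ
    rw [hρ.trace_eq, hρ'.trace_eq] at h
    exact_mod_cast h.symm
  have h := sum_mul_log_le_of_sum_sq_div_le (w := overlap U V) (p := fun x => p x.2)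
    (q := fun x => q x.1) (w' := overlap U' V') (p' := fun x => p' x.2) (q' := fun x => q' x.1)
    (fun x => hρ.nonneg x.2) (fun x => hσ.nonneg x.1)
    (fun x hx => hρ.overlap_mul_eq_zero (hs _ hx) x.2)
    (fun x => hρ'.nonneg x.2) (fun x => hσ'.nonneg x.1)
    (fun x hx => hρ'.overlap_mul_eq_zero (hs' _ hx) x.2)
    (by rw [hρ.sum_overlap_mul hσ.unitary, hρ'.sum_overlap_mul hσ'.unitary, htr])
    (fun t ht => by
      obtain ⟨Y, hY⟩ := exists_quadForm_eq hρ' hσ' ht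
      rw [← hY]
      exact (quadForm_map_le hK hρ.posSemidef hσ.posSemidef ht.le Y).trans
        (quadForm_le hρ hσ ht _))
  simp only [mul_assoc] at h
  rw [hρ.sum_overlap_mul hσ.unitary fun i => p i * Real.log (p i),
    hρ'.sum_overlap_mul hσ'.unitary fun i => p' i * Real.log (p' i),
    Fintype.sum_prod_type, Fintype.sum_prod_type] at h
  simpa only [Finset.sum_mul, mul_assoc] using h

end Monotonicity

section ConditionalEntropy

/-- The partial trace over the second tensor factor. -/
def traceRight {n r : Type} [Fintype r] (τ : Matrix (n × r) (n × r) ℂ) : Matrix n n ℂ :=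
  Matrix.of fun b b' => ∑ s, τ (b, s) (b', s)

theorem Matrix.PosSemidef.traceRight {n r : Type} [Fintype r]
    {τ : Matrix (n × r) (n × r) ℂ} (h : τ.PosSemidef) :
    (traceRight τ).PosSemidef := by
  have : _root_.traceRight τ = ∑ s, τ.submatrix (fun b => (b, s)) (fun b => (b, s)) := by
    ext b b'
    simp [_root_.traceRight, Matrix.sum_apply]
  rw [this]
  exact Matrix.posSemidef_sum _ fun s _ => h.submatrix _

theorem traceRight_map {m n r κ : Type} [Fintype n] [Fintype r] [DecidableEq r] [Fintype κ]
    (K : κ → Matrix m n ℂ)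
    (τ : Matrix (n × r) (n × r) ℂ) :
    traceRight (∑ k, (K k ⊗ₖ (1 : Matrix r r ℂ)) * τ * (K k ⊗ₖ (1 : Matrix r r ℂ))ᴴ) =
      ∑ k, K k * traceRight τ * (K k)ᴴ := by
  ext b b'
  simp only [traceRight, Matrix.of_apply, Matrix.sum_apply]
  rw [Finset.sum_comm]
  refine Finset.sum_congr rfl fun k _ => ?_
  simp only [Matrix.mul_apply, Fintype.sum_prod_type, Matrix.conjTranspose_apply,
    Matrix.kroneckerMap_apply, Matrix.one_apply, Matrix.of_apply, mul_ite, mul_one,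
    mul_zero, apply_ite star, star_zero, ite_mul, zero_mul, Finset.sum_ite_eq,
    Finset.mem_univ, if_true, Finset.sum_mul, Finset.mul_sum]
  rw [Finset.sum_comm]
  refine Finset.sum_congr rfl fun c _ => ?_
  rw [Finset.sum_comm]

variable {m n r κ : Type} [Fintype m] [DecidableEq m] [Fintype n] [DecidableEq n]
  [Fintype r] [DecidableEq r] [Fintype κ]

theorem SpectralDecomp.kronecker_one {ρ V : Matrix n n ℂ} {q : n → ℝ}
    (h : SpectralDecomp ρ V q) :
    SpectralDecomp (ρ ⊗ₖ (1 : Matrix r r ℂ)) (V ⊗ₖ (1 : Matrix r r ℂ)) fun x => q x.1 where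
  unitary := by
    rw [Matrix.conjTranspose_kronecker, ← Matrix.mul_kronecker_mul, h.unitary,
      Matrix.conjTranspose_one, Matrix.one_mul, Matrix.one_kronecker_one]
  eq := by
    have : Matrix.diagonal (fun x : n × r => (q x.1 : ℂ)) =
        Matrix.diagonal (fun i => (q i : ℂ)) ⊗ₖ (1 : Matrix r r ℂ) := by
      rw [← Matrix.diagonal_one, Matrix.diagonal_kronecker_diagonal]
      simp
    rw [this, Matrix.conjTranspose_kronecker, ← Matrix.mul_kronecker_mul,
      ← Matrix.mul_kronecker_mul, ← h.eq, Matrix.conjTranspose_one, Matrix.one_mul, Matrix.one_mul]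
  nonneg x := h.nonneg x.1

theorem SpectralDecomp.sum_sum_overlap_kronecker_one {τ U : Matrix (n × r) (n × r) ℂ}
    {p : n × r → ℝ} {V : Matrix n n ℂ} {q : n → ℝ} (h : SpectralDecomp τ U p)
    (hB : SpectralDecomp (traceRight τ) V q) (j : n) :
    ∑ s, ∑ i, overlap U (V ⊗ₖ (1 : Matrix r r ℂ)) ((j, s), i) * p i = q j := by
  have h1 : (Vᴴ * traceRight τ * V) j j = q j := by
    rw [hB.eq]
    have : Vᴴ * (V * Matrix.diagonal (fun i => (q i : ℂ)) * Vᴴ) * V =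
        (Vᴴ * V) * Matrix.diagonal (fun i => (q i : ℂ)) * (Vᴴ * V) := by
      simp only [Matrix.mul_assoc]
    rw [this, hB.unitary, Matrix.one_mul, Matrix.mul_one, Matrix.diagonal_apply_eq]
  rw [← Complex.ofReal_inj, ← h1, Complex.ofReal_sum]
  simp only [h.sum_overlap_mul_eq_diag]
  simp only [Matrix.mul_apply, Fintype.sum_prod_type, Matrix.conjTranspose_apply,
    Matrix.kroneckerMap_apply, Matrix.one_apply, traceRight, Matrix.of_apply, mul_ite, mul_one,
    mul_zero, apply_ite star, star_zero, ite_mul, zero_mul, Finset.sum_ite_eq',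
    Finset.mem_univ, if_true, Finset.sum_mul, Finset.mul_sum]
  rw [Finset.sum_comm]
  refine Finset.sum_congr rfl fun b _ => ?_
  rw [Finset.sum_comm]

theorem vnEntropy_mul_log_two {ρ : Matrix n n ℂ} (h : ρ.PosSemidef) :
    vnEntropy ρ * Real.log 2 =
      -∑ i, h.isHermitian.eigenvalues i * Real.log (h.isHermitian.eigenvalues i) := by
  have h2 : Real.log 2 ≠ 0 := (Real.log_pos one_lt_two).ne'
  rw [vnEntropy, dif_pos h.isHermitian, neg_mul, Finset.sum_mul]
  congr 1
  refine Finset.sum_congr rfl fun i _ => ?_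
  rw [Real.logb, mul_assoc, div_mul_cancel₀ _ h2]

/-- The conditional entropy does not decrease under a channel acting on the conditioning
system. -/
theorem vnEntropy_traceRight_sub_map_le {K : κ → Matrix m n ℂ}
    (hK : ∑ k, (K k)ᴴ * K k = 1) {τ : Matrix (n × r) (n × r) ℂ} (hτ : τ.PosSemidef)
    {τ' : Matrix (m × r) (m × r) ℂ}
    (hτ' : τ' = ∑ k, (K k ⊗ₖ (1 : Matrix r r ℂ)) * τ * (K k ⊗ₖ (1 : Matrix r r ℂ))ᴴ) :
    vnEntropy (traceRight τ') - vnEntropy τ' ≤ vnEntropy (traceRight τ) - vnEntropy τ := by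
  have hpos' : τ'.PosSemidef := by
    rw [hτ']
    exact Matrix.posSemidef_sum _ fun k _ => hτ.mul_mul_conjTranspose_same _
  have hK1 : ∑ k, (K k ⊗ₖ (1 : Matrix r r ℂ))ᴴ * (K k ⊗ₖ (1 : Matrix r r ℂ)) = 1 := by
    simp only [Matrix.conjTranspose_kronecker, ← Matrix.mul_kronecker_mul,
      Matrix.conjTranspose_one, Matrix.one_mul]
    rw [← Matrix.one_kronecker_one, ← hK]
    ext x y
    simp [Matrix.sum_apply, Finset.sum_mul]
  have hσ' : traceRight τ' ⊗ₖ (1 : Matrix r r ℂ) = ∑ k, (K k ⊗ₖ (1 : Matrix r r ℂ)) *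
      (traceRight τ ⊗ₖ (1 : Matrix r r ℂ)) * (K k ⊗ₖ (1 : Matrix r r ℂ))ᴴ := by
    simp only [Matrix.conjTranspose_kronecker, ← Matrix.mul_kronecker_mul,
      Matrix.conjTranspose_one, Matrix.one_mul]
    rw [hτ', traceRight_map]
    ext x y
    simp [Matrix.sum_apply, Finset.sum_mul]
  have d := hτ.spectralDecomp
  have e := hτ.traceRight.spectralDecomp
  have d' := hpos'.spectralDecomp
  have e' := hpos'.traceRight.spectralDecomp
  have support : ∀ {k : Type} [Fintype k] [DecidableEq k] {ω U : Matrix (k × r) (k × r) ℂ}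
      {p : k × r → ℝ} {V : Matrix k k ℂ} {q : k → ℝ}, SpectralDecomp ω U p →
      SpectralDecomp (traceRight ω) V q → ∀ j : k × r, q j.1 = 0 →
      ∑ i, overlap U (V ⊗ₖ (1 : Matrix r r ℂ)) (j, i) * p i = 0 := by
    intro k _ _ ω U p V q hω hB j hj
    have := hω.sum_sum_overlap_kronecker_one hB j.1
    rw [hj] at this
    exact (Finset.sum_eq_zero_iff_of_nonneg fun s _ => Finset.sum_nonneg fun i _ =>
      mul_nonneg (Complex.normSq_nonneg _) (hω.nonneg i)).mp this j.2 (Finset.mem_univ _)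
  have h := relEntropy_map_le hK1 d (e.kronecker_one (r := r)) (hτ' ▸ d')
    (hσ' ▸ e'.kronecker_one (r := r)) (support d e) (support d' e')
  simp only [Fintype.sum_prod_type (γ := ℝ) (fun x : _ × _ => (∑ i, _) * Real.log _),
    ← Finset.sum_mul, d.sum_sum_overlap_kronecker_one e,
    d'.sum_sum_overlap_kronecker_one e'] at h
  have h2 : 0 < Real.log 2 := Real.log_pos one_lt_two
  refine le_of_mul_le_mul_right ?_ h2
  rw [sub_mul, sub_mul, vnEntropy_mul_log_two hτ, vnEntropy_mul_log_two hpos',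
    vnEntropy_mul_log_two hτ.traceRight, vnEntropy_mul_log_two hpos'.traceRight]
  linarith

end ConditionalEntropy

section DataProcessing

namespace KrausFamily

variable {a b c : Type} [Fintype a] [DecidableEq a] [Fintype b] [DecidableEq b]
  [Fintype c] [DecidableEq c]

/-- The matrix whose rows are the vectorized operators `Kᵢ Y`. -/
def vecMatrix (N : KrausFamily a b) (Y : Matrix a a ℂ) : Matrix N.ι (b × a) ℂ :=
  Matrix.of fun k x => (N.K k * Y) x.1 x.2

/-- The joint state of output and reference when the input `Y Yᴴ` is purified by `Y`. -/
noncomputable def jointOutput (N : KrausFamily a b) (Y : Matrix a a ℂ) :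
    Matrix (b × a) (b × a) ℂ :=
  ((N.vecMatrix Y)ᴴ * N.vecMatrix Y)ᵀ

theorem jointOutput_posSemidef (N : KrausFamily a b) (Y : Matrix a a ℂ) :
    (N.jointOutput Y).PosSemidef :=
  (Matrix.posSemidef_conjTranspose_mul_self _).transpose

theorem compl_eq_vecMatrix_mul (N : KrausFamily a b) (Y : Matrix a a ℂ) :
    N.compl (Y * Yᴴ) = N.vecMatrix Y * (N.vecMatrix Y)ᴴ := by
  ext i j
  have : N.K i * (Y * Yᴴ) * (N.K j)ᴴ = (N.K i * Y) * (N.K j * Y)ᴴ := by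
    simp only [Matrix.conjTranspose_mul, Matrix.mul_assoc]
  rw [compl, Matrix.of_apply, this, Matrix.mul_apply, Fintype.sum_prod_type, Matrix.trace]
  simp only [Matrix.diag_apply, Matrix.mul_apply (M := N.K i * Y), Matrix.conjTranspose_apply,
    vecMatrix, Matrix.of_apply]

/-- The environment and the joint output of a purified input have the same entropy. -/
theorem vnEntropy_compl (N : KrausFamily a b) (Y : Matrix a a ℂ) :
    vnEntropy (N.compl (Y * Yᴴ)) = vnEntropy (N.jointOutput Y) := by
  rw [compl_eq_vecMatrix_mul, vnEntropy_mul_conjTranspose_self, jointOutput,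
    vnEntropy_transpose (Matrix.isHermitian_conjTranspose_mul_self _)]

theorem jointOutput_apply (N : KrausFamily a b) (Y : Matrix a a ℂ) (x y : b × a) :
    N.jointOutput Y x y = N.apply (Y * Matrix.single x.2 y.2 1 * Yᴴ) x.1 y.1 := by
  rw [jointOutput, Matrix.transpose_apply, Matrix.mul_apply, apply, Matrix.sum_apply]
  refine Finset.sum_congr rfl fun k _ => ?_
  have : N.K k * (Y * Matrix.single x.2 y.2 1 * Yᴴ) * (N.K k)ᴴ =
      (N.K k * Y) * Matrix.single x.2 y.2 (1 : ℂ) * (N.K k * Y)ᴴ := by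
    simp only [Matrix.conjTranspose_mul, Matrix.mul_assoc]
  rw [this, Matrix.mul_apply, Finset.sum_eq_single y.2]
  · simp [vecMatrix, mul_comm]
  · intro j _ hj
    simp [Matrix.mul_single_apply_of_ne (hbj := hj)]
  · simp

theorem traceRight_jointOutput (N : KrausFamily a b) (Y : Matrix a a ℂ) :
    traceRight (N.jointOutput Y) = N.apply (Y * Yᴴ) := by
  have h : Y * Yᴴ = ∑ s, Y * Matrix.single s s 1 * Yᴴ := by
    rw [← Finset.sum_mul, ← Finset.mul_sum, Matrix.sum_single_one, Matrix.mul_one]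
  ext i j
  simp only [traceRight, Matrix.of_apply, jointOutput_apply]
  rw [h]
  simp only [apply, Matrix.sum_apply]
  rw [Finset.sum_comm]
  refine Finset.sum_congr rfl fun k _ => ?_
  rw [Matrix.mul_sum, Matrix.sum_mul, Matrix.sum_apply]

theorem jointOutput_comp {N : KrausFamily a b} {T : KrausFamily a c} {R : KrausFamily c b}
    (hcomp : ∀ ρ : Matrix a a ℂ, N.apply ρ = R.apply (T.apply ρ)) (Y : Matrix a a ℂ) :
    N.jointOutput Y = ∑ k, (R.K k ⊗ₖ (1 : Matrix a a ℂ)) * T.jointOutput Y *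
      (R.K k ⊗ₖ (1 : Matrix a a ℂ))ᴴ := by
  ext x y
  rw [jointOutput_apply, hcomp, apply, Matrix.sum_apply, Matrix.sum_apply]
  refine Finset.sum_congr rfl fun k _ => ?_
  simp only [Matrix.mul_apply (M := R.K k ⊗ₖ (1 : Matrix a a ℂ) * T.jointOutput Y),
    Matrix.mul_apply (M := R.K k ⊗ₖ (1 : Matrix a a ℂ)),
    Matrix.mul_apply (M := R.K k * T.apply _), Matrix.mul_apply (M := R.K k), jointOutput_apply,
    Fintype.sum_prod_type, Matrix.conjTranspose_apply,
    Matrix.kroneckerMap_apply, Matrix.one_apply, mul_ite, mul_one,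
    mul_zero, apply_ite star, star_zero, ite_mul, zero_mul, Finset.sum_ite_eq,
    Finset.mem_univ, if_true]

/-- The quantum data processing inequality for the coherent information. -/
theorem cohInfo_comp_le {N : KrausFamily a b} {T : KrausFamily a c} {R : KrausFamily c b}
    (hR : R.IsChannel) (hcomp : ∀ ρ : Matrix a a ℂ, N.apply ρ = R.apply (T.apply ρ))
    {φ : Matrix a a ℂ} (hφ : φ.PosSemidef) : cohInfo N φ ≤ cohInfo T φ := by
  obtain ⟨X, hX⟩ := hφ.exists_eq_mul_conjTranspose
  have h := vnEntropy_traceRight_sub_map_le hR (T.jointOutput_posSemidef X)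
    (jointOutput_comp hcomp X)
  rwa [traceRight_jointOutput, traceRight_jointOutput, ← vnEntropy_compl, ← vnEntropy_compl,
    ← hX] at h

end KrausFamily

end DataProcessing

section ChannelOutput

namespace KrausFamily

variable {a b : Type} [Fintype a] [DecidableEq a] [Fintype b] [DecidableEq b]

theorem IsChannel.isDensity_apply {N : KrausFamily a b} (hN : N.IsChannel) {φ : Matrix a a ℂ}
    (hφ : IsDensity φ) : IsDensity (N.apply φ) :=
  ⟨Matrix.posSemidef_sum _ fun _ _ => hφ.1.mul_mul_conjTranspose_same _,
    (trace_map hN φ).trans hφ.2⟩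

theorem IsChannel.isDensity_compl {N : KrausFamily a b} (hN : N.IsChannel) {φ : Matrix a a ℂ}
    (hφ : IsDensity φ) : IsDensity (N.compl φ) := by
  constructor
  · obtain ⟨X, hX⟩ := hφ.1.exists_eq_mul_conjTranspose
    rw [hX, compl_eq_vecMatrix_mul]
    exact Matrix.posSemidef_self_mul_conjTranspose _
  · rw [← hφ.2, ← trace_map hN φ, Matrix.trace_sum]
    rfl

theorem IsChannel.cohInfo_le {N : KrausFamily a b} (hN : N.IsChannel) {φ : Matrix a a ℂ}
    (hφ : IsDensity φ) : cohInfo N φ ≤ Real.logb 2 (Fintype.card b) := by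
  have h1 := vnEntropy_le_logb_card (hN.isDensity_apply hφ)
  have h2 := vnEntropy_nonneg (hN.isDensity_compl hφ)
  rw [cohInfo]
  linarith

theorem IsChannel.Q1_le {N : KrausFamily a b} (hN : N.IsChannel) :
    Q1 N ≤ Real.logb 2 (Fintype.card b) := by
  refine Real.sSup_le ?_ (div_nonneg (Real.log_natCast_nonneg _) (Real.log_nonneg one_le_two))
  rintro x ⟨φ, hφ, rfl⟩
  exact hN.cohInfo_le hφ

end KrausFamily

end ChannelOutput

section TensorPower

namespace KrausFamily

variable {a b c : Type} [Fintype a] [DecidableEq a] [Fintype b] [DecidableEq b]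
  [Fintype c] [DecidableEq c]

/-- The matrix coefficients of a Kraus family, viewed as a linear map on matrices. -/
noncomputable def coeff (N : KrausFamily a b) (y y' : b) (x x' : a) : ℂ :=
  ∑ k, N.K k y x * star (N.K k y' x')

theorem apply_apply (N : KrausFamily a b) (ρ : Matrix a a ℂ) (y y' : b) :
    N.apply ρ y y' = ∑ x : a × a, N.coeff y y' x.1 x.2 * ρ x.1 x.2 := by
  simp only [apply, Matrix.sum_apply, coeff, Finset.sum_mul]
  rw [Finset.sum_comm]
  refine Finset.sum_congr rfl fun k _ => ?_
  simp only [Matrix.mul_apply, Finset.sum_mul, Matrix.conjTranspose_apply]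
  rw [Fintype.sum_prod_type_right]
  refine Finset.sum_congr rfl fun x' _ => Finset.sum_congr rfl fun x _ => ?_
  ring

theorem coeff_eq_apply_single (N : KrausFamily a b) (y y' : b) (x x' : a) :
    N.coeff y y' x x' = N.apply (Matrix.single x x' 1) y y' := by
  rw [apply_apply, Finset.sum_eq_single (x, x')]
  · simp
  · rintro ⟨i, j⟩ _ hij
    have h : ¬(x = i ∧ x' = j) := fun h => hij (by rw [h.1, h.2])
    simp [h]
  · simp

theorem apply_comp_iff {N : KrausFamily a b} {T : KrausFamily a c} {R : KrausFamily c b} :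
    (∀ ρ : Matrix a a ℂ, N.apply ρ = R.apply (T.apply ρ)) ↔
      ∀ y y' x x', N.coeff y y' x x' = ∑ z : c × c, R.coeff y y' z.1 z.2 * T.coeff z.1 z.2 x x' := by
  constructor
  · intro h y y' x x'
    rw [coeff_eq_apply_single, h, apply_apply]
    simp only [coeff_eq_apply_single T]
  · intro h ρ
    ext y y'
    simp only [apply_apply, h, Finset.sum_mul, Finset.mul_sum]
    rw [Finset.sum_comm]
    simp only [mul_assoc]

theorem coeff_pow (N : KrausFamily a b) (n : ℕ) (y y' : Fin n → b) (x x' : Fin n → a) :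
    (N.pow n).coeff y y' x x' = ∏ i, N.coeff (y i) (y' i) (x i) (x' i) := by
  simp only [coeff, Finset.prod_univ_sum, Fintype.piFinset_univ]
  refine Finset.sum_congr rfl fun f _ => ?_
  simp [pow, Finset.prod_mul_distrib]

theorem apply_pow_comp {N : KrausFamily a b} {T : KrausFamily a c} {R : KrausFamily c b}
    (hcomp : ∀ ρ : Matrix a a ℂ, N.apply ρ = R.apply (T.apply ρ)) (n : ℕ)
    (ρ : Matrix (Fin n → a) (Fin n → a) ℂ) :
    (N.pow n).apply ρ = (R.pow n).apply ((T.pow n).apply ρ) := by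
  revert ρ
  rw [apply_comp_iff]
  intro y y' x x'
  simp only [coeff_pow, apply_comp_iff.mp hcomp, Finset.prod_univ_sum, Fintype.piFinset_univ,
    ← Finset.prod_mul_distrib]
  exact Fintype.sum_equiv (Equiv.arrowProdEquivProdArrow (Fin n) (fun _ => c) fun _ => c)
    _ _ fun _ => rfl

theorem IsChannel.pow {N : KrausFamily a b} (hN : N.IsChannel) (n : ℕ) :
    (N.pow n).IsChannel := by
  have h : ∀ x x' : a, ∑ z : N.ι × b, star (N.K z.1 z.2 x) * N.K z.1 z.2 x' =
      (1 : Matrix a a ℂ) x x' := by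
    intro x x'
    rw [← hN, Matrix.sum_apply, Fintype.sum_prod_type]
    simp only [Matrix.mul_apply, Matrix.conjTranspose_apply]
  ext x x'
  have h1 : (1 : Matrix (Fin n → a) (Fin n → a) ℂ) x x' =
      ∏ i, (1 : Matrix a a ℂ) (x i) (x' i) := by
    simp only [Matrix.one_apply, Finset.prod_ite_zero, Finset.prod_const_one, funext_iff,
      Finset.mem_univ, true_implies]
  simp only [h1, ← h, Finset.prod_univ_sum, Fintype.piFinset_univ, Matrix.sum_apply,
    Matrix.mul_apply, Matrix.conjTranspose_apply]
  rw [← Fintype.sum_prod_type']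
  refine (Fintype.sum_equiv (Equiv.arrowProdEquivProdArrow (Fin n) (fun _ => N.ι) fun _ => b)
    _ _ fun f => ?_).symm
  simp [KrausFamily.pow, Finset.prod_mul_distrib, Equiv.arrowProdEquivProdArrow]

theorem Q1_pow_comp_le {N : KrausFamily a b} {T : KrausFamily a c} {R : KrausFamily c b}
    (hT : T.IsChannel) (hR : R.IsChannel)
    (hcomp : ∀ ρ : Matrix a a ℂ, N.apply ρ = R.apply (T.apply ρ)) (n : ℕ) :
    Q1 (N.pow n) ≤ Q1 (T.pow n) := by
  by_cases hne : ∃ φ : Matrix (Fin n → a) (Fin n → a) ℂ, IsDensity φ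
  · obtain ⟨φ₀, hφ₀⟩ := hne
    refine csSup_le ⟨_, φ₀, hφ₀, rfl⟩ ?_
    rintro x ⟨φ, hφ, rfl⟩
    refine (cohInfo_comp_le (hR.pow n) (apply_pow_comp hcomp n) hφ.1).trans
      (le_csSup ⟨Real.logb 2 (Fintype.card (Fin n → c)), ?_⟩ ⟨φ, hφ, rfl⟩)
    rintro x ⟨ψ, hψ, rfl⟩
    exact (hT.pow n).cohInfo_le hψ
  · have hempty : ∀ {d : Type} [Fintype d] [DecidableEq d]
        (M : KrausFamily (Fin n → a) d), Q1 M = 0 := by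
      intro d _ _ M
      have : {x | ∃ φ, IsDensity φ ∧ x = cohInfo M φ} = ∅ :=
        Set.eq_empty_of_forall_notMem fun x ⟨φ, hφ, _⟩ => hne ⟨φ, hφ⟩
      rw [Q1, this, Real.sSup_empty]
    rw [hempty, hempty]

theorem IsChannel.Q1_pow_div_le_Qcap {T : KrausFamily a c} (hT : T.IsChannel) {n : ℕ}
    (hn : 0 < n) : (1 / (n : ℝ)) * Q1 (T.pow n) ≤ Qcap T := by
  refine le_csSup ⟨Real.logb 2 (Fintype.card c), ?_⟩ ⟨n, hn, rfl⟩
  rintro x ⟨k, hk, rfl⟩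
  have hk' : (0 : ℝ) < k := by exact_mod_cast hk
  have h := (hT.pow k).Q1_le
  rw [Fintype.card_fun, Fintype.card_fin, Nat.cast_pow, Real.logb_pow] at h
  rw [one_div, inv_mul_le_iff₀ hk']
  exact h

end KrausFamily

end TensorPower

/-- If `T` is an additive extension of the quantum channel `N`, i.e. there
is a channel `R` with `N = R ∘ T` and `Q(T) = Q^{(1)}(T)`, then `Q(N) ≤ Q^{(1)}(T)`. -/
theorem quantum_capacity_le_of_additive_extension
    {A B B' : Type} [Fintype A] [DecidableEq A] [Fintype B] [DecidableEq B]
    [Fintype B'] [DecidableEq B']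
    (N : KrausFamily A B) (T : KrausFamily A B') (R : KrausFamily B' B)
    (hN : N.IsChannel) (hT : T.IsChannel) (hR : R.IsChannel)
    (hcomp : ∀ ρ : Matrix A A ℂ, N.apply ρ = R.apply (T.apply ρ))
    (hadd : Qcap T = Q1 T) :
    Qcap N ≤ Q1 T := by
  rw [← hadd]
  refine csSup_le ⟨_, 1, one_pos, rfl⟩ ?_
  rintro x ⟨n, hn, rfl⟩
  exact (mul_le_mul_of_nonneg_left (KrausFamily.Q1_pow_comp_le hT hR hcomp n)
    (by positivity)).trans (hT.Q1_pow_div_le_Qcap hn)
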